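/- arXiv:1111.6128 — 8 statements merged into one kernel-verified Lean document; each statement's English description precedes it below -/
import Mathlib

section
/- Let (g,[,]) be a finite-dimensional semisimple Lie algebra over ℂ and let ∘ be a bilinear operation on g making (g,[,],∘) a PostLie algebra. Then there exists a linear map f : g → g such that x∘y = [f(x),y] for all x,y ∈ g, and f satisfies [f(x),f(y)] = f([f(x),y] + [x,f(y)] + [x,y]) for all x,y ∈ g (i.e., f is a Rota-Baxter operator of weight 1). -/
theorem LieAlgebra.IsKilling.eq_of_forall_lie_eq {K L : Type*} [Field K] [LieRing L]
    [LieAlgebra K L] [FiniteDimensional K L] [LieAlgebra.IsKilling K L] {a b : L}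
    (h : ∀ x : L, ⁅a, x⁆ = ⁅b, x⁆) : a = b := by
  have hc : a - b ∈ LieAlgebra.center K L := by
    rw [LieModule.mem_maxTrivSubmodule]
    intro x
    rw [← lie_skew, sub_lie, h, sub_self, neg_zero]
  rwa [LieAlgebra.center_eq_bot, LieSubmodule.mem_bot, sub_eq_zero] at hc

theorem LieAlgebra.IsKilling.exists_linearMap_eq_lie {K V L : Type*} [Field K]
    [AddCommGroup V] [Module K V] [LieRing L]
    [LieAlgebra K L] [FiniteDimensional K L] [LieAlgebra.IsKilling K L]
    (D : V →ₗ[K] L →ₗ[K] L) (hD : ∀ (v : V) (x y : L), D v ⁅x, y⁆ = ⁅D v x, y⁆ + ⁅x, D v y⁆) :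
    ∃ f : V →ₗ[K] L, ∀ v x, D v x = ⁅f v, x⁆ := by
  have inner (v : V) : ∃ a : L, ∀ x, D v x = ⁅a, x⁆ := by
    let d : LieDerivation K L L :=
      { toLinearMap := D v
        leibniz' := fun x y => by
          rw [hD, ← lie_skew y, sub_neg_eq_add, add_comm] }
    obtain ⟨a, ha⟩ := LieDerivation.IsKilling.exists_eq_ad d
    exact ⟨a, fun x => by
      rw [← LieDerivation.ad_apply_apply K, ha]
      rfl⟩
  choose f hf using inner
  refine ⟨{ toFun := f, map_add' := fun v w => ?_, map_smul' := fun c v => ?_ }, hf⟩ <;>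
    refine eq_of_forall_lie_eq (K := K) fun x => ?_
  · simp [← hf, add_lie]
  · simp [← hf, smul_lie]


/-- On a finite-dimensional semisimple complex Lie algebra `g`,
any PostLie algebra structure `∘` is of the form `x∘y = [f(x),y]` for a
(unique) linear map `f` which is a Rota-Baxter operator of weight 1. -/
theorem statement1 (g : Type*) [LieRing g] [LieAlgebra ℂ g]
    [FiniteDimensional ℂ g] [LieAlgebra.IsSemisimple ℂ g]
    (circ : g →ₗ[ℂ] g →ₗ[ℂ] g)
    (post1 : ∀ x y z : g, circ z (circ y x) - circ y (circ z x) + circ (circ y z) x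
      - circ (circ z y) x + circ ⁅y, z⁆ x = 0)
    (post2 : ∀ x y z : g, circ z ⁅x, y⁆ = ⁅circ z x, y⁆ + ⁅x, circ z y⁆) :
    ∃ f : g →ₗ[ℂ] g,
      (∀ x y : g, circ x y = ⁅f x, y⁆) ∧
      (∀ x y : g, ⁅f x, f y⁆ = f (⁅f x, y⁆ + ⁅x, f y⁆ + ⁅x, y⁆)) := by
  obtain ⟨f, hf⟩ := LieAlgebra.IsKilling.exists_linearMap_eq_lie circ fun z x y => post2 x y z
  refine ⟨f, hf, fun y z => LieAlgebra.IsKilling.eq_of_forall_lie_eq (K := ℂ) fun x => ?_⟩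
  have h := post1 x y z
  simp only [hf] at h
  rw [← lie_skew y (f z), lie_lie, map_add, map_add, map_neg, add_lie, add_lie, neg_lie,
    ← sub_eq_zero, ← neg_eq_zero, ← h]
  abel
end

section
/- Every 3×3 complex matrix A satisfying the matrix equation Aᵀ((tr(A)+1)I₃ − A) = adj(A) is SO(3,ℂ)-congruent to one of the following matrices: M₁ = 0; M₂ = −I₃; M₃ = [[−1,0,0],[0,−(1+i)/2,(i−1)/2],[0,−(1+i)/2,(i−1)/2]]; M₄(k) = [[k,0,0],[0,−1/2,i/2],[0,−i/2,−1/2]] for some k ∈ ℂ; M₅ = [[−1/2+i, 1−i/2, 0],[1+i/2, −1/2−i, 0],[0,0,0]]. -/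
open Matrix Complex

/-- M₃ = [[−1,0,0],[0,−(1+i)/2,(i−1)/2],[0,−(1+i)/2,(i−1)/2]] -/
noncomputable def M3 : Matrix (Fin 3) (Fin 3) ℂ :=
  !![-1, 0, 0;
     0, -(1 + Complex.I)/2, (Complex.I - 1)/2;
     0, -(1 + Complex.I)/2, (Complex.I - 1)/2]

/-- M₄(k) = [[k,0,0],[0,−1/2,i/2],[0,−i/2,−1/2]] -/
noncomputable def M4 (k : ℂ) : Matrix (Fin 3) (Fin 3) ℂ :=
  !![k, 0, 0;
     0, -1/2, Complex.I/2;
     0, -Complex.I/2, -1/2]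

/-- M₅ = [[−1/2+i, 1−i/2, 0],[1+i/2, −1/2−i, 0],[0,0,0]] -/
noncomputable def M5 : Matrix (Fin 3) (Fin 3) ℂ :=
  !![-1/2 + Complex.I, 1 - Complex.I/2, 0;
     1 + Complex.I/2, -1/2 - Complex.I, 0;
     0, 0, 0]


/-- The matrix equation `Aᵀ((tr(A)+1)I₃ − A) = adj(A)`. -/
def IsSolution (A : Matrix (Fin 3) (Fin 3) ℂ) : Prop :=
  Aᵀ * ((A.trace + 1) • (1 : Matrix (Fin 3) (Fin 3) ℂ) - A) = A.adjugate

/-- `A` is `SO(3,ℂ)`-congruent to one of the listed normal forms. -/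
def HasNormalForm (A : Matrix (Fin 3) (Fin 3) ℂ) : Prop :=
  ∃ T : Matrix (Fin 3) (Fin 3) ℂ, Tᵀ * T = 1 ∧ T.det = 1 ∧
    (Tᵀ * A * T = 0 ∨ Tᵀ * A * T = -1 ∨ Tᵀ * A * T = M3 ∨
      (∃ k : ℂ, Tᵀ * A * T = M4 k) ∨ Tᵀ * A * T = M5)

theorem adjugate_eq_transpose {T : Matrix (Fin 3) (Fin 3) ℂ} (hT : Tᵀ * T = 1)
    (hd : T.det = 1) : T.adjugate = Tᵀ := by
  have h : T.adjugate * (T * Tᵀ) = Tᵀ := by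
    rw [← Matrix.mul_assoc, adjugate_mul, hd, one_smul, Matrix.one_mul]
  rwa [mul_eq_one_comm.mp hT, Matrix.mul_one] at h

theorem IsSolution.congr {A T : Matrix (Fin 3) (Fin 3) ℂ} (hA : IsSolution A)
    (hT : Tᵀ * T = 1) (hd : T.det = 1) : IsSolution (Tᵀ * A * T) := by
  have hT' : T * Tᵀ = 1 := mul_eq_one_comm.mp hT
  have htr : (Tᵀ * A * T).trace = A.trace := by
    rw [trace_mul_cycle, hT', Matrix.one_mul]
  have hadj : (Tᵀ * A * T).adjugate = Tᵀ * A.adjugate * T := by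
    rw [adjugate_mul_distrib, adjugate_mul_distrib, ← adjugate_transpose,
      adjugate_eq_transpose hT hd, transpose_transpose, Matrix.mul_assoc]
  have key : (A.trace + 1) • (1 : Matrix (Fin 3) (Fin 3) ℂ) - Tᵀ * A * T =
      Tᵀ * ((A.trace + 1) • (1 : Matrix (Fin 3) (Fin 3) ℂ) - A) * T := by
    simp only [Matrix.mul_sub, Matrix.sub_mul, Matrix.mul_smul, Matrix.smul_mul, Matrix.mul_one, hT]
  unfold IsSolution at *
  rw [htr, hadj, key, ← hA]
  simp only [transpose_mul, transpose_transpose, Matrix.mul_assoc]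
  rw [← Matrix.mul_assoc T Tᵀ, hT', Matrix.one_mul]

theorem HasNormalForm.of_congr {A T : Matrix (Fin 3) (Fin 3) ℂ} (hT : Tᵀ * T = 1)
    (hd : T.det = 1) (h : HasNormalForm (Tᵀ * A * T)) : HasNormalForm A := by
  obtain ⟨S, hS, hSd, h⟩ := h
  refine ⟨T * S, ?_, by rw [det_mul, hd, hSd, one_mul], ?_⟩
  · rw [transpose_mul, Matrix.mul_assoc, ← Matrix.mul_assoc Tᵀ, hT, Matrix.one_mul, hS]
  · simpa only [transpose_mul, Matrix.mul_assoc] using h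

/-- A unit vector is the first column of some matrix in `SO(3,ℂ)`, generic case. -/
theorem exists_rotation_of_ne {a b c : ℂ} (h : a ^ 2 + b ^ 2 + c ^ 2 = 1) (ha : 1 + a ≠ 0) :
    ∃ T : Matrix (Fin 3) (Fin 3) ℂ, Tᵀ * T = 1 ∧ T.det = 1 ∧
      T 0 0 = a ∧ T 1 0 = b ∧ T 2 0 = c := by
  obtain ⟨s, hs⟩ : ∃ s, s * (1 + a) = 1 := ⟨_, inv_mul_cancel₀ ha⟩
  have h1 : s * (b ^ 2 + c ^ 2) = 1 - a := by linear_combination s * h + (1 - a) * hs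
  refine ⟨!![a, -b, -c; b, 1 - s * b ^ 2, -(s * b * c); c, -(s * b * c), 1 - s * c ^ 2],
    ?_, ?_, rfl, rfl, rfl⟩
  · ext i j
    fin_cases i <;> fin_cases j <;> simp [Matrix.mul_apply, Fin.sum_univ_three] <;> grind
  · rw [det_fin_three]
    simp
    grind

theorem exists_rotation {a b c : ℂ} (h : a ^ 2 + b ^ 2 + c ^ 2 = 1) :
    ∃ T : Matrix (Fin 3) (Fin 3) ℂ, Tᵀ * T = 1 ∧ T.det = 1 ∧
      T 0 0 = a ∧ T 1 0 = b ∧ T 2 0 = c := by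
  by_cases ha : 1 + a = 0
  · have ha' : 1 + -a ≠ 0 := fun h' => two_ne_zero (α := ℂ) (by linear_combination ha + h')
    obtain ⟨T, hT, hd, h0, h1, h2⟩ :=
      exists_rotation_of_ne (a := -a) (b := -b) (c := -c) (by linear_combination h) ha'
    refine ⟨T * diagonal ![-1, -1, 1], ?_, ?_, by simp [h0], by simp [h1], by simp [h2]⟩
    · rw [transpose_mul, Matrix.mul_assoc, ← Matrix.mul_assoc Tᵀ, hT, Matrix.one_mul,
        diagonal_transpose, diagonal_mul_diagonal, ← diagonal_one]
      congr 1
      ext i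
      fin_cases i <;> simp
    · simp [hd, Fin.prod_univ_three]
  · exact exists_rotation_of_ne h ha

theorem isSolution_iff_entries {a b c d e f g h i : ℂ} :
    IsSolution !![a, b, c; d, e, f; g, h, i] ↔
      (a * (e + i + 1) - d ^ 2 - g ^ 2 = e * i - f * h ∧
      -(a * b) + d * (a + i + 1) - g * h = c * h - b * i ∧
      -(a * c) - d * f + g * (a + e + 1) = b * f - c * e) ∧
      (b * (e + i + 1) - e * d - h * g = f * g - d * i ∧
      -b ^ 2 + e * (a + i + 1) - h ^ 2 = a * i - c * g ∧
      -(b * c) - e * f + h * (a + e + 1) = c * d - a * f) ∧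
      c * (e + i + 1) - f * d - i * g = d * h - e * g ∧
      -(c * b) + f * (a + i + 1) - i * h = b * g - a * h ∧
      -c ^ 2 - f ^ 2 + i * (a + e + 1) = a * e - b * d := by
  unfold IsSolution
  rw [adjugate_fin_three_of, ← Matrix.ext_iff]
  simp only [Fin.forall_fin_succ, Matrix.mul_apply, Fin.sum_univ_three, trace_fin_three]
  simp
  ring_nf

theorem IsSolution.axis_eigenvector {a b c d e f g h i : ℂ}
    (hA : IsSolution !![a, b, c; d, e, f; g, h, i]) :
    2 * a * (h - f) + (b + d) * (c - g) + (c + g) * (d - b) = 2 * (a + e + i + 1) * (h - f) ∧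
    (b + d) * (h - f) + 2 * e * (c - g) + (f + h) * (d - b) = 2 * (a + e + i + 1) * (c - g) ∧
    (c + g) * (h - f) + (f + h) * (c - g) + 2 * i * (d - b) = 2 * (a + e + i + 1) * (d - b) := by
  obtain ⟨⟨h11, h12, h13⟩, ⟨h21, h22, h23⟩, h31, h32, h33⟩ := isSolution_iff_entries.mp hA
  refine ⟨?_, ?_, ?_⟩
  · linear_combination 2 * (h32 - h23)
  · linear_combination 2 * (h13 - h31)
  · linear_combination 2 * (h21 - h12)

theorem IsSolution.axis_sq {a b c d e f g h i : ℂ}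
    (hA : IsSolution !![a, b, c; d, e, f; g, h, i]) (hne : ¬(h = f ∧ c = g ∧ d = b)) :
    (h - f) ^ 2 + (c - g) ^ 2 + (d - b) ^ 2 = -1 := by
  obtain ⟨s1, s2, s3⟩ := hA.axis_eigenvector
  obtain ⟨⟨h11, h12, h13⟩, ⟨h21, h22, h23⟩, h31, h32, h33⟩ := isSolution_iff_entries.mp hA
  obtain ⟨m, hm⟩ : ∃ m, m = (a * e - b * d) + (a * i - c * g) + (e * i - f * h)
      + (a + e + i + 1) := ⟨_, rfl⟩
  have e1 : m * (h - f) = 0 := by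
    rw [hm]
    linear_combination -(h11 * (h - f) + (h12 + h21) / 2 * (c - g) + (h13 + h31) / 2 * (d - b))
      - ((2 * a + 1) * s1 + (b + d - (b - d) / 2) * s2 + (c + g - (c - g) / 2) * s3) / 2
  have e2 : m * (c - g) = 0 := by
    rw [hm]
    linear_combination -((h12 + h21) / 2 * (h - f) + h22 * (c - g) + (h23 + h32) / 2 * (d - b))
      - ((b + d + (b - d) / 2) * s1 + (2 * e + 1) * s2 + (f + h - (f - h) / 2) * s3) / 2
  have e3 : m * (d - b) = 0 := by
    rw [hm]
    linear_combination -((h13 + h31) / 2 * (h - f) + (h23 + h32) / 2 * (c - g) + h33 * (d - b))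
      - ((c + g + (c - g) / 2) * s1 + (f + h + (f - h) / 2) * s2 + (2 * i + 1) * s3) / 2
  have hm0 : m = 0 := by
    by_contra h0
    exact hne ⟨sub_eq_zero.mp ((mul_eq_zero.mp e1).resolve_left h0),
      sub_eq_zero.mp ((mul_eq_zero.mp e2).resolve_left h0),
      sub_eq_zero.mp ((mul_eq_zero.mp e3).resolve_left h0)⟩
  linear_combination -(h11 + h22 + h33) + hm0 - hm

theorem IsSolution.eq_of_symmetric {a b c e f i : ℂ}
    (hA : IsSolution !![a, b, c; b, e, f; c, f, i]) :
    !![a, b, c; b, e, f; c, f, i] = 0 ∨ !![a, b, c; b, e, f; c, f, i] = -1 := by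
  obtain ⟨⟨h11, h12, h13⟩, ⟨h21, h22, h23⟩, h31, h32, h33⟩ := isSolution_iff_entries.mp hA
  have hb : b = 0 := by
    linear_combination 2 * (a * h12 + b * h22 + c * h32) + h12 - 2 * b * (h11 + h22 + h33)
  have hc : c = 0 := by
    linear_combination 2 * (a * h13 + b * h23 + c * h33) + h13 - 2 * c * (h11 + h22 + h33)
  have hf : f = 0 := by
    linear_combination 2 * (b * h13 + e * h23 + f * h33) + h23 - 2 * f * (h11 + h22 + h33)
  have hae : e = a := by
    linear_combination 2 * (b * h12 + e * h22 + f * h32) + h22 - 2 * e * (h11 + h22 + h33)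
      - (2 * (a * h11 + b * h21 + c * h31) + h11 - 2 * a * (h11 + h22 + h33))
  have hai : i = a := by
    linear_combination 2 * (c * h13 + f * h23 + i * h33) + h33 - 2 * i * (h11 + h22 + h33)
      - (2 * (a * h11 + b * h21 + c * h31) + h11 - 2 * a * (h11 + h22 + h33))
  subst hb hc hf hae hai
  have : i * (i + 1) = 0 := by linear_combination h11
  rcases mul_eq_zero.mp this with h0 | h0
  · left
    ext j k
    fin_cases j <;> fin_cases k <;> simp [h0]
  · right
    have h0 : i = -1 := eq_neg_of_add_eq_zero_left h0
    ext j k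
    fin_cases j <;> fin_cases k <;> simp [h0]

/-- The shape of a solution whose skew part is `(i/2)(E₂₃ - E₃₂)`. -/
theorem IsSolution.entries_of_axis {a b c d e f g h i : ℂ}
    (hA : IsSolution !![a, b, c; d, e, f; g, h, i]) (h1 : h - f = -I) (h2 : c = g) (h3 : d = b) :
    ∃ p r : ℂ, !![a, b, c; d, e, f; g, h, i] =
        !![a, 0, 0; 0, -1/2 + p, r + I/2; 0, r - I/2, -1/2 - p] ∧
      (p = 0 ∧ r = 0 ∨ a = 0 ∧ r = I * p ∨ a = -1 ∧ r = -(I * p)) := by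
  obtain ⟨s1, s2, s3⟩ := hA.axis_eigenvector
  obtain ⟨⟨h11, h12, h13⟩, ⟨h21, h22, h23⟩, h31, h32, h33⟩ := isSolution_iff_entries.mp hA
  subst h2 h3
  obtain rfl : h = f - I := by linear_combination h1
  have hI : I * I = -1 := I_mul_I
  have hei : e + i = -1 := by linear_combination (-I / 2) * s1 + (e + i + 1) * hI
  obtain rfl : d = 0 := by linear_combination (I / 2) * s2 + d * hI
  obtain rfl : c = 0 := by linear_combination (I / 2) * s3 + c * hI
  obtain ⟨p, rfl⟩ : ∃ p, e = -1/2 + p := ⟨e + 1/2, by ring⟩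
  obtain ⟨r, rfl⟩ : ∃ r, f = r + I/2 := ⟨f - I/2, by ring⟩
  obtain rfl : i = -1/2 - p := by linear_combination hei
  refine ⟨p, r, by congr! 4; ring_nf, ?_⟩
  have hpr : (r - I * p) * (r + I * p) = 0 := by grind
  have hr : (2 * a + 1) * p = -(I * r) := by grind
  by_cases hp : p = 0
  · left
    grind
  right
  rcases mul_eq_zero.mp hpr with h0 | h0
  · left
    have : a * p = 0 := by grind
    grind
  · right
    have : (a + 1) * p = 0 := by grind
    grind

theorem exists_rotation_sq {s t : ℂ} (hs : s ^ 2 = -1) (ht : t ≠ 0) :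
    ∃ x y : ℂ, x ^ 2 + y ^ 2 = 1 ∧ (x + s * y) ^ 2 = t := by
  obtain ⟨z, hz⟩ := IsAlgClosed.exists_pow_nat_eq t two_pos
  have hz0 : z ≠ 0 := by
    rintro rfl
    exact ht (by simpa using hz.symm)
  obtain ⟨w, hw⟩ : ∃ w, w * z = 1 := ⟨_, inv_mul_cancel₀ hz0⟩
  refine ⟨(z + w) / 2, -s * (z - w) / 2, ?_, ?_⟩ <;> grind

/-- Rotating about the first axis rescales the nilpotent symmetric part. -/
theorem hasNormalForm_of_rescale {a p s q : ℂ} (hs : s ^ 2 = -1) (hp : p ≠ 0) (hq : q ≠ 0)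
    (h : HasNormalForm !![a, 0, 0; 0, -1/2 + q, s * q + I/2; 0, s * q - I/2, -1/2 - q]) :
    HasNormalForm !![a, 0, 0; 0, -1/2 + p, s * p + I/2; 0, s * p - I/2, -1/2 - p] := by
  obtain ⟨x, y, hxy, hq'⟩ := exists_rotation_sq hs (div_ne_zero hq hp)
  rw [eq_div_iff hp] at hq'
  refine HasNormalForm.of_congr (T := !![1, 0, 0; 0, x, -y; 0, y, x]) ?_ ?_ ?_
  · ext j k
    fin_cases j <;> fin_cases k <;> simp [Matrix.mul_apply, Fin.sum_univ_three] <;> grind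
  · simp [det_fin_three]
    grind
  · convert h using 1
    ext j k
    fin_cases j <;> fin_cases k <;> simp [Matrix.mul_apply, Fin.sum_univ_three] <;> grind

theorem IsSolution.hasNormalForm_of_axis {a b c d e f g h i : ℂ}
    (hA : IsSolution !![a, b, c; d, e, f; g, h, i]) (h1 : h - f = -I) (h2 : c = g) (h3 : d = b) :
    HasNormalForm !![a, b, c; d, e, f; g, h, i] := by
  obtain ⟨p, r, hM, hpr⟩ := hA.entries_of_axis h1 h2 h3
  rw [hM]
  have hM4 : HasNormalForm !![a, 0, 0; 0, -1/2, I/2; 0, -I/2, -1/2] :=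
    ⟨1, by simp, by simp, Or.inr <| Or.inr <| Or.inr <| Or.inl ⟨a, by simp [M4]⟩⟩
  by_cases hp : p = 0
  · obtain rfl : r = 0 := by rcases hpr with h | h | h <;> simp [h, hp]
    simpa [hp, neg_div] using hM4
  rcases hpr with ⟨hp', -⟩ | ⟨rfl, rfl⟩ | ⟨rfl, rfl⟩
  · exact absurd hp' hp
  · refine hasNormalForm_of_rescale I_sq hp I_ne_zero
      ⟨!![0, 0, -1; 1, 0, 0; 0, -1, 0], ?_, by simp [det_fin_three], ?_⟩
    · ext j k
      fin_cases j <;> fin_cases k <;> simp [Matrix.mul_apply, Fin.sum_univ_three]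
    · refine Or.inr <| Or.inr <| Or.inr <| Or.inr ?_
      ext j k
      fin_cases j <;> fin_cases k <;> simp [Matrix.mul_apply, Fin.sum_univ_three, M5] <;> ring
  · rw [← neg_mul]
    refine hasNormalForm_of_rescale (q := -I / 2) (by simp) hp (by simp)
      ⟨1, by simp, by simp, Or.inr <| Or.inr <| Or.inl ?_⟩
    ext j k
    fin_cases j <;> fin_cases k <;> simp [M3] <;> grind [I_mul_I]

theorem IsSolution.hasNormalForm {A : Matrix (Fin 3) (Fin 3) ℂ} (hA : IsSolution A) :
    HasNormalForm A := by
  have hA' := hA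
  rw [eta_fin_three A] at hA'
  by_cases hsym : A 2 1 = A 1 2 ∧ A 0 2 = A 2 0 ∧ A 1 0 = A 0 1
  · obtain ⟨h1, h2, h3⟩ := hsym
    rw [h1, ← h2, h3] at hA'
    have := hA'.eq_of_symmetric
    have hAs : A = !![A 0 0, A 0 1, A 0 2; A 0 1, A 1 1, A 1 2; A 0 2, A 1 2, A 2 2] := by
      conv_lhs => rw [eta_fin_three A, h1, ← h2, h3]
    rw [← hAs] at this
    refine ⟨1, by simp, by simp, ?_⟩
    rcases this with h | h <;> simp [h]
  · have hq := hA'.axis_sq hsym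
    obtain ⟨T, hT, hd, t0, t1, t2⟩ := exists_rotation
      (a := I * (A 2 1 - A 1 2)) (b := I * (A 0 2 - A 2 0)) (c := I * (A 1 0 - A 0 1))
      (by linear_combination I ^ 2 * hq - I_sq)
    refine HasNormalForm.of_congr hT hd ?_
    have hB := hA.congr hT hd
    have hadj := adjugate_eq_transpose hT hd
    rw [adjugate_fin_three, ← Matrix.ext_iff] at hadj
    rw [← Matrix.ext_iff] at hT
    simp only [Fin.forall_fin_succ, Matrix.mul_apply, Fin.sum_univ_three] at hadj hT
    simp at hadj hT
    obtain ⟨⟨c00, c10, c20⟩, ⟨c01, c11, c21⟩, c02, c12, c22⟩ := hadj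
    obtain ⟨⟨o0, o1, o2⟩, -⟩ := hT
    have u0 : A 2 1 - A 1 2 = -I * T 0 0 := by
      linear_combination I * t0 + (A 2 1 - A 1 2) * I_sq
    have u1 : A 0 2 - A 2 0 = -I * T 1 0 := by
      linear_combination I * t1 + (A 0 2 - A 2 0) * I_sq
    have u2 : A 1 0 - A 0 1 = -I * T 2 0 := by
      linear_combination I * t2 + (A 1 0 - A 0 1) * I_sq
    rw [eta_fin_three (Tᵀ * A * T)] at hB ⊢
    refine hB.hasNormalForm_of_axis ?_ ?_ ?_ <;>
      simp only [Matrix.mul_apply, Fin.sum_univ_three, transpose_apply]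
    · linear_combination (A 2 1 - A 1 2) * c00 + (A 0 2 - A 2 0) * c10 + (A 1 0 - A 0 1) * c20
        + T 0 0 * u0 + T 1 0 * u1 + T 2 0 * u2 - I * o0
    · linear_combination (A 2 1 - A 1 2) * c01 + (A 0 2 - A 2 0) * c11 + (A 1 0 - A 0 1) * c21
        + T 0 1 * u0 + T 1 1 * u1 + T 2 1 * u2 - I * o1
    · linear_combination (A 2 1 - A 1 2) * c02 + (A 0 2 - A 2 0) * c12 + (A 1 0 - A 0 1) * c22
        + T 0 2 * u0 + T 1 2 * u1 + T 2 2 * u2 - I * o2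

/-- Every solution of `Aᵀ((tr(A)+1)I₃ − A) = adj(A)` is
`SO(3,ℂ)`-congruent to one of `0`, `−I₃`, `M₃`, `M₄(k)` (some `k ∈ ℂ`), `M₅`. -/
theorem statement10 (A : Matrix (Fin 3) (Fin 3) ℂ)
    (hA : Aᵀ * ((A.trace + 1) • (1 : Matrix (Fin 3) (Fin 3) ℂ) - A) = A.adjugate) :
    ∃ T : Matrix (Fin 3) (Fin 3) ℂ, Tᵀ * T = 1 ∧ T.det = 1 ∧
      (Tᵀ * A * T = 0 ∨ Tᵀ * A * T = -1 ∨ Tᵀ * A * T = M3 ∨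
        (∃ k : ℂ, Tᵀ * A * T = M4 k) ∨ Tᵀ * A * T = M5) := by
  exact IsSolution.hasNormalForm hA
end

section
/- No two distinct matrices from the following list are SO(3,ℂ)-congruent: M₁ = 0; M₂ = −I₃; M₃ = [[−1,0,0],[0,−(1+i)/2,(i−1)/2],[0,−(1+i)/2,(i−1)/2]]; M₄(k) = [[k,0,0],[0,−1/2,i/2],[0,−i/2,−1/2]] for k ∈ ℂ; M₅ = [[−1/2+i, 1−i/2, 0],[1+i/2, −1/2−i, 0],[0,0,0]]. In particular, M₄(k) and M₄(k') are not SO(3,ℂ)-congruent when k ≠ k'. -/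
open Matrix Complex

/-- `SO(3,ℂ)`-congruence of 3×3 complex matrices: `B = TᵀAT` for some
`T` with `TᵀT = I₃` and `det T = 1`. -/
def SOCong (A B : Matrix (Fin 3) (Fin 3) ℂ) : Prop :=
  ∃ T : Matrix (Fin 3) (Fin 3) ℂ, Tᵀ * T = 1 ∧ T.det = 1 ∧ B = Tᵀ * A * T

namespace SOCong

variable {A B : Matrix (Fin 3) (Fin 3) ℂ}

theorem symm (h : SOCong A B) : SOCong B A := by
  obtain ⟨T, hT, hdet, rfl⟩ := h
  have hT' : T * Tᵀ = 1 := mul_eq_one_comm.mp hT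
  refine ⟨Tᵀ, by rwa [transpose_transpose], by rwa [det_transpose], ?_⟩
  calc A = (T * Tᵀ) * A * (T * Tᵀ) := by rw [hT', one_mul, mul_one]
    _ = Tᵀᵀ * (Tᵀ * A * T) * Tᵀ := by simp only [transpose_transpose, Matrix.mul_assoc]

theorem eq_zero (h : SOCong 0 B) : B = 0 := by
  obtain ⟨T, -, -, rfl⟩ := h
  simp

theorem eq_neg_one (h : SOCong (-1) B) : B = -1 := by
  obtain ⟨T, hT, -, rfl⟩ := h
  simp [hT]

theorem trace_eq (h : SOCong A B) : B.trace = A.trace := by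
  obtain ⟨T, hT, -, rfl⟩ := h
  rw [Matrix.trace_mul_comm, ← Matrix.mul_assoc, mul_eq_one_comm.mp hT, one_mul]

theorem commute_transpose (h : SOCong A B) (hA : Commute A Aᵀ) : Commute B Bᵀ := by
  obtain ⟨T, hT, -, rfl⟩ := h
  have conj_mul (X Y : Matrix (Fin 3) (Fin 3) ℂ) :
      (Tᵀ * X * T) * (Tᵀ * Y * T) = Tᵀ * (X * Y) * T := by
    calc (Tᵀ * X * T) * (Tᵀ * Y * T) = Tᵀ * X * (T * Tᵀ) * Y * T := by
          simp only [Matrix.mul_assoc]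
      _ = Tᵀ * (X * Y) * T := by
          rw [mul_eq_one_comm.mp hT, mul_one, Matrix.mul_assoc Tᵀ]
  have htr : (Tᵀ * A * T)ᵀ = Tᵀ * Aᵀ * T := by
    simp only [transpose_mul, transpose_transpose, Matrix.mul_assoc]
  rw [htr, Commute, SemiconjBy, conj_mul, conj_mul, hA.eq]

end SOCong

theorem trace_M3 : M3.trace = -2 := by
  simp [M3, trace_fin_three]
  ring

theorem trace_M4 (k : ℂ) : (M4 k).trace = k - 1 := by
  simp [M4, trace_fin_three]
  ring

theorem trace_M5 : M5.trace = -1 := by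
  simp [M5, trace_fin_three]

theorem commute_M4_transpose (k : ℂ) : Commute (M4 k) (M4 k)ᵀ := by
  ext i j
  fin_cases i <;> fin_cases j <;> simp [M4, mul_apply, Fin.sum_univ_three] <;> ring

theorem not_commute_M3_transpose : ¬ Commute M3 M3ᵀ := by
  intro h
  have h11 := congrFun (congrFun h.eq 1) 1
  simp [M3, mul_apply, Fin.sum_univ_three] at h11
  have : I = 0 := by linear_combination (-1) * h11
  exact I_ne_zero this

theorem not_commute_M5_transpose : ¬ Commute M5 M5ᵀ := by
  intro h
  have h00 := congrFun (congrFun h.eq 0) 0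
  simp [M5, mul_apply, Fin.sum_univ_three] at h00
  have : I = 0 := by linear_combination (-1 / 2) * h00
  exact I_ne_zero this

/-- No two distinct matrices among `0`, `−I₃`, `M₃`, `M₄(k)`
(`k ∈ ℂ`), `M₅` are `SO(3,ℂ)`-congruent; in particular `M₄(k)` and `M₄(k')`
are not congruent when `k ≠ k'`. -/
theorem statement12 :
    ¬ SOCong 0 (-1) ∧
    ¬ SOCong 0 M3 ∧
    (∀ k : ℂ, ¬ SOCong 0 (M4 k)) ∧
    ¬ SOCong 0 M5 ∧
    ¬ SOCong (-1) M3 ∧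
    (∀ k : ℂ, ¬ SOCong (-1) (M4 k)) ∧
    ¬ SOCong (-1) M5 ∧
    (∀ k : ℂ, ¬ SOCong M3 (M4 k)) ∧
    ¬ SOCong M3 M5 ∧
    (∀ k : ℂ, ¬ SOCong (M4 k) M5) ∧
    (∀ k k' : ℂ, k ≠ k' → ¬ SOCong (M4 k) (M4 k')) := by
  refine ⟨fun h => ?_, fun h => ?_, fun k h => ?_, fun h => ?_, fun h => ?_, fun k h => ?_,
    fun h => ?_, fun k h => ?_, fun h => ?_, fun k h => ?_, fun k k' hk h => ?_⟩
  · simpa using h.eq_zero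
  · simpa [trace_M3] using h.trace_eq
  · have := congrFun (congrFun h.eq_zero 1) 1
    simp [M4] at this
  · simpa [trace_M5] using h.trace_eq
  · have := h.trace_eq
    norm_num [trace_M3] at this
  · have := congrFun (congrFun h.eq_neg_one 1) 1
    norm_num [M4] at this
  · have := h.trace_eq
    norm_num [trace_M5] at this
  · exact not_commute_M3_transpose (h.symm.commute_transpose (commute_M4_transpose k))
  · have := h.trace_eq
    norm_num [trace_M3, trace_M5] at this
  · exact not_commute_M5_transpose (h.commute_transpose (commute_M4_transpose k))
  · have := h.trace_eq
    rw [trace_M4, trace_M4] at this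
    exact hk (sub_left_injective this).symm
end

section
/- For every 3×3 complex symmetric matrix A there exists T ∈ SO(3,ℂ) such that TAT⁻¹ (= TATᵀ) is one of the following matrices: diag(λ₁,λ₂,λ₃); [[λ₁,0,0],[0,λ₂+i,1],[0,1,λ₂−i]]; [[λ,1+i,0],[1+i,λ,1−i],[0,1−i,λ]]; diag(λ₁,λ₂,0) with λ₁λ₂ ≠ 0; [[λ+i,1,0],[1,λ−i,0],[0,0,0]] with λ ≠ 0; [[λ,0,0],[0,i,1],[0,1,−i]] with λ ≠ 0; [[0,1+i,0],[1+i,0,1−i],[0,1−i,0]]; diag(λ,0,0) with λ ≠ 0; [[i,1,0],[1,−i,0],[0,0,0]]; and the zero matrix; where λ, λ₁, λ₂, λ₃ ∈ ℂ. -/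
open Matrix Complex

/-- The Gram matrix of a hyperbolic frame `(e, w, f)`: `e` and `f` are isotropic with `e ⬝ᵥ f = 1`,
and `w` is a unit vector orthogonal to both. -/
def hyperbolicGram : Matrix (Fin 3) (Fin 3) ℂ := !![0, 0, 1; 0, 1, 0; 1, 0, 0]

lemma exists_special_orthogonal_of_orthogonal {A N T : Matrix (Fin 3) (Fin 3) ℂ}
    (hT : T * Tᵀ = 1) (hN : T * A * Tᵀ = N) :
    ∃ S : Matrix (Fin 3) (Fin 3) ℂ, Sᵀ * S = 1 ∧ S.det = 1 ∧ S * A * Sᵀ = N := by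
  have hT' : Tᵀ * T = 1 := mul_eq_one_comm.mp hT
  have hd : T.det * T.det = 1 := by
    simpa [det_mul, det_transpose] using congrArg det hT
  rcases mul_self_eq_one_iff.mp hd with h | h
  · exact ⟨T, hT', h, hN⟩
  · refine ⟨-T, by simpa using hT', ?_, by simpa using hN⟩
    rw [det_neg, h]
    norm_num

lemma exists_ne_zero_pow_eq {z : ℂ} (hz : z ≠ 0) {n : ℕ} (hn : 0 < n) :
    ∃ s : ℂ, s ≠ 0 ∧ s ^ n = z := by
  obtain ⟨s, hs⟩ := IsAlgClosed.exists_pow_nat_eq z hn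
  refine ⟨s, ?_, hs⟩
  rintro rfl
  exact hz (by rw [← hs, zero_pow hn.ne'])

/-- Passing from a hyperbolic frame `P` to an orthonormal frame with coordinates `C`. -/
lemma exists_special_orthogonal_of_frame {A N P M : Matrix (Fin 3) (Fin 3) ℂ}
    (hP : P * Pᵀ = hyperbolicGram) (hM : P * A * Pᵀ = M) (C : Matrix (Fin 3) (Fin 3) ℂ)
    (hC : C * hyperbolicGram * Cᵀ = 1) (hN : C * M * Cᵀ = N) :
    ∃ S : Matrix (Fin 3) (Fin 3) ℂ, Sᵀ * S = 1 ∧ S.det = 1 ∧ S * A * Sᵀ = N := by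
  apply exists_special_orthogonal_of_orthogonal (T := C * P)
  · rw [← hC, ← hP, transpose_mul]
    simp only [Matrix.mul_assoc]
  · rw [← hN, ← hM, transpose_mul]
    simp only [Matrix.mul_assoc]

lemma of_mul_transpose_of (a b c : Fin 3 → ℂ) : of ![a, b, c] * (of ![a, b, c])ᵀ =
    !![a ⬝ᵥ a, a ⬝ᵥ b, a ⬝ᵥ c; a ⬝ᵥ b, b ⬝ᵥ b, b ⬝ᵥ c; a ⬝ᵥ c, b ⬝ᵥ c, c ⬝ᵥ c] := by
  ext i j
  fin_cases i <;> fin_cases j <;> first | rfl | exact dotProduct_comm _ _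

lemma exists_frame_of_isotropic {v : Fin 3 → ℂ} (hv : v ≠ 0) (h : v ⬝ᵥ v = 0) :
    ∃ P : Matrix (Fin 3) (Fin 3) ℂ, P * Pᵀ = hyperbolicGram ∧ P 0 = v := by
  obtain ⟨i, hi⟩ := Function.ne_iff.mp hv
  obtain ⟨x, hx⟩ : ∃ x : Fin 3 → ℂ, v ⬝ᵥ x = 1 :=
    ⟨Pi.single i (v i)⁻¹, by simpa using mul_inv_cancel₀ hi⟩
  obtain ⟨f, hf, hvf⟩ : ∃ f : Fin 3 → ℂ, f ⬝ᵥ f = 0 ∧ v ⬝ᵥ f = 1 := by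
    refine ⟨x - (x ⬝ᵥ x / 2) • v, ?_, ?_⟩
    · simp [h, hx, dotProduct_comm x v]
      ring
    · simp [h, hx]
  refine ⟨of ![v, I • (v ⨯₃ f), f], ?_, rfl⟩
  have hfw : (v ⨯₃ f) ⬝ᵥ f = 0 := by rw [dotProduct_comm, dot_cross_self]
  rw [of_mul_transpose_of]
  simp only [smul_dotProduct, dotProduct_smul, dot_self_cross, cross_dot_cross,
    h, hf, hvf, hfw, dotProduct_comm f v, smul_eq_mul]
  simp [hyperbolicGram]

lemma exists_frame_of_unit {v : Fin 3 → ℂ} (h : v ⬝ᵥ v = 1) :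
    ∃ P : Matrix (Fin 3) (Fin 3) ℂ, P * Pᵀ = hyperbolicGram ∧ P 1 = v := by
  obtain ⟨y, hy, hvy⟩ : ∃ y : Fin 3 → ℂ, y ⬝ᵥ y ≠ 0 ∧ v ⬝ᵥ y = 0 := by
    by_contra! hcon
    have key : ∀ u : Fin 3 → ℂ, (v ⨯₃ u) ⬝ᵥ (v ⨯₃ u) = 0 := fun u => by
      by_contra hu
      exact hcon _ hu (dot_self_cross v u)
    have h0 := key ![1, 0, 0]
    have h1 := key ![0, 1, 0]
    have h2 := key ![0, 0, 1]
    simp [cross_apply, dotProduct, Fin.sum_univ_three] at h h0 h1 h2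
    grind
  obtain ⟨s, hs0, hs⟩ := exists_ne_zero_pow_eq hy two_pos
  obtain ⟨x, hx, hvx⟩ : ∃ x : Fin 3 → ℂ, x ⬝ᵥ x = 1 ∧ v ⬝ᵥ x = 0 := by
    refine ⟨s⁻¹ • y, ?_, by simp [hvy]⟩
    simp [← hs]
    field_simp
  refine ⟨of ![x + I • (v ⨯₃ x), v, (1 / 2 : ℂ) • (x - I • (v ⨯₃ x))], ?_, rfl⟩
  have hxw : (v ⨯₃ x) ⬝ᵥ x = 0 := by rw [dotProduct_comm, dot_cross_self]
  have hvw : (v ⨯₃ x) ⬝ᵥ v = 0 := by rw [dotProduct_comm, dot_self_cross]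
  rw [of_mul_transpose_of]
  simp only [smul_dotProduct, dotProduct_smul, add_dotProduct, dotProduct_add, sub_dotProduct,
    dotProduct_sub, dot_self_cross, dot_cross_self, cross_dot_cross, h, hx, hvx, hxw, hvw,
    dotProduct_comm x v, smul_eq_mul]
  simp [hyperbolicGram]
  constructor
  · norm_num
  · linear_combination (1 / 2) * I_sq

lemma frame_mul_apply_of_eigenvector {A P G : Matrix (Fin 3) (Fin 3) ℂ} (hA : Aᵀ = A)
    (hP : P * Pᵀ = G) {l : ℂ} (i : Fin 3) (hi : A *ᵥ P i = l • P i) (j : Fin 3) :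
    (P * A * Pᵀ) i j = l * G i j ∧ (P * A * Pᵀ) j i = l * G i j := by
  have hij : (P * A * Pᵀ) j i = l * G i j := by
    have h1 : (P * A * Pᵀ) j i = P j ⬝ᵥ (A *ᵥ P i) := by
      rw [Matrix.mul_assoc]
      rfl
    rw [h1, hi, dotProduct_smul, dotProduct_comm, ← hP]
    rfl
  refine ⟨?_, hij⟩
  have hs : (P * A * Pᵀ)ᵀ = P * A * Pᵀ := by
    simp [transpose_mul, hA, Matrix.mul_assoc]
  rw [← hs, transpose_apply, hij]

/-- The three families of canonical forms; the remaining matrices of `statement14` are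
specializations of these, up to a permutation of the coordinates. -/
def HasCanonicalForm (A : Matrix (Fin 3) (Fin 3) ℂ) : Prop :=
  ∃ T : Matrix (Fin 3) (Fin 3) ℂ, Tᵀ * T = 1 ∧ T.det = 1 ∧
    ((∃ l1 l2 l3 : ℂ, T * A * Tᵀ = !![l1, 0, 0; 0, l2, 0; 0, 0, l3]) ∨
     (∃ l1 l2 : ℂ, T * A * Tᵀ = !![l1, 0, 0; 0, l2 + I, 1; 0, 1, l2 - I]) ∨
     (∃ l : ℂ, T * A * Tᵀ = !![l, 1 + I, 0; 1 + I, l, 1 - I; 0, 1 - I, l]))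

lemma hasCanonicalForm_of_block_scalar {A P : Matrix (Fin 3) (Fin 3) ℂ}
    {l q : ℂ}
    (hP : P * Pᵀ = hyperbolicGram) (hM : P * A * Pᵀ = !![0, 0, q; 0, l, 0; q, 0, 0]) :
    HasCanonicalForm A := by
  have hI := I_sq
  obtain ⟨S, h1, h2, h3⟩ := exists_special_orthogonal_of_frame
    (N := !![l, 0, 0; 0, q, 0; 0, 0, q]) hP hM
    !![0, 1, 0; 1, 0, 1 / 2; I, 0, -I / 2]
    (by
      ext a b
      fin_cases a <;> fin_cases b <;>
        simp [hyperbolicGram, mul_apply, Fin.sum_univ_three] <;> grind)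
    (by
      ext a b
      fin_cases a <;> fin_cases b <;>
        simp [mul_apply, Fin.sum_univ_three] <;> grind)
  exact ⟨S, h1, h2, .inl ⟨_, _, _, h3⟩⟩

lemma hasCanonicalForm_of_block_upper {A P : Matrix (Fin 3) (Fin 3) ℂ}
    {l p q : ℂ} (hp : p ≠ 0)
    (hP : P * Pᵀ = hyperbolicGram) (hM : P * A * Pᵀ = !![p, 0, q; 0, l, 0; q, 0, 0]) :
    HasCanonicalForm A := by
  have hI := I_sq
  obtain ⟨s, hs0, hs⟩ := exists_ne_zero_pow_eq (z := 2 / p) (by simp [*]) (n := 2) (by norm_num)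
  have hsp : s ^ 2 * p = 2 := by
    rw [hs]
    field_simp
  obtain ⟨S, h1, h2, h3⟩ := exists_special_orthogonal_of_frame
    (N := !![l, 0, 0; 0, q + I, 1; 0, 1, q - I]) hP hM
    !![0, 1, 0;
      (1 + I) / 2 * s, 0, (1 - I) / 2 * s⁻¹;
      (1 - I) / 2 * s, 0, (1 + I) / 2 * s⁻¹]
    (by
      ext a b
      fin_cases a <;> fin_cases b <;>
        simp [hyperbolicGram, mul_apply, Fin.sum_univ_three] <;> grind)
    (by
      ext a b
      fin_cases a <;> fin_cases b <;>
        simp [mul_apply, Fin.sum_univ_three] <;> grind)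
  exact ⟨S, h1, h2, .inr (.inl ⟨_, _, h3⟩)⟩

lemma hasCanonicalForm_of_block_lower {A P : Matrix (Fin 3) (Fin 3) ℂ}
    {l q r : ℂ} (hr : r ≠ 0)
    (hP : P * Pᵀ = hyperbolicGram) (hM : P * A * Pᵀ = !![0, 0, q; 0, l, 0; q, 0, r]) :
    HasCanonicalForm A := by
  have hI := I_sq
  obtain ⟨s, hs0, hs⟩ := exists_ne_zero_pow_eq (z := 2 / r) (by simp [*]) (n := 2) (by norm_num)
  have hsp : s ^ 2 * r = 2 := by
    rw [hs]
    field_simp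
  obtain ⟨S, h1, h2, h3⟩ := exists_special_orthogonal_of_frame
    (N := !![l, 0, 0; 0, q + I, 1; 0, 1, q - I]) hP hM
    !![0, 1, 0;
      (1 - I) / 2 * s⁻¹, 0, (1 + I) / 2 * s;
      (1 + I) / 2 * s⁻¹, 0, (1 - I) / 2 * s]
    (by
      ext a b
      fin_cases a <;> fin_cases b <;>
        simp [hyperbolicGram, mul_apply, Fin.sum_univ_three] <;> grind)
    (by
      ext a b
      fin_cases a <;> fin_cases b <;>
        simp [mul_apply, Fin.sum_univ_three] <;> grind)
  exact ⟨S, h1, h2, .inr (.inl ⟨_, _, h3⟩)⟩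

lemma hasCanonicalForm_of_block_full {A P : Matrix (Fin 3) (Fin 3) ℂ}
    {l p q r : ℂ} (hp : p ≠ 0) (hr : r ≠ 0)
    (hP : P * Pᵀ = hyperbolicGram) (hM : P * A * Pᵀ = !![p, 0, q; 0, l, 0; q, 0, r]) :
    HasCanonicalForm A := by
  have hI := I_sq
  obtain ⟨s, hs0, hs⟩ := exists_ne_zero_pow_eq (z := r / (4 * p)) (by simp [*]) (n := 4) (by norm_num)
  have hsp : s ^ 4 * (4 * p) = r := by
    rw [hs]
    field_simp
  obtain ⟨S, h1, h2, h3⟩ := exists_special_orthogonal_of_frame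
    (N := !![l, 0, 0; 0, q + 2 * s ^ 2 * p, 0; 0, 0, q - 2 * s ^ 2 * p]) hP hM
    !![0, 1, 0; s, 0, s⁻¹ / 2; I * s, 0, -I * s⁻¹ / 2]
    (by
      ext a b
      fin_cases a <;> fin_cases b <;>
        simp [hyperbolicGram, mul_apply, Fin.sum_univ_three] <;> grind)
    (by
      ext a b
      fin_cases a <;> fin_cases b <;>
        simp [mul_apply, Fin.sum_univ_three] <;> grind)
  exact ⟨S, h1, h2, .inl ⟨_, _, _, h3⟩⟩

lemma hasCanonicalForm_of_unit_eigenvector {A : Matrix (Fin 3) (Fin 3) ℂ} (hA : Aᵀ = A)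
    {v : Fin 3 → ℂ} {l : ℂ} (hv : v ⬝ᵥ v = 1) (hl : A *ᵥ v = l • v) : HasCanonicalForm A := by
  obtain ⟨P, hP, rfl⟩ := exists_frame_of_unit hv
  have hrow := frame_mul_apply_of_eigenvector hA hP 1 hl
  have hs : (P * A * Pᵀ)ᵀ = P * A * Pᵀ := by
    simp [transpose_mul, hA, Matrix.mul_assoc]
  obtain ⟨p, q, r, hM⟩ : ∃ p q r : ℂ, P * A * Pᵀ = !![p, 0, q; 0, l, 0; q, 0, r] := by
    refine ⟨(P * A * Pᵀ) 0 0, (P * A * Pᵀ) 0 2, (P * A * Pᵀ) 2 2, ?_⟩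
    generalize P * A * Pᵀ = M at *
    have h20 : M 2 0 = M 0 2 := congrFun (congrFun hs 0) 2
    ext a b
    fin_cases a <;> fin_cases b <;>
      simp [hrow, h20, hyperbolicGram]
  by_cases hp : p = 0
  · subst hp
    by_cases hr : r = 0
    · subst hr
      exact hasCanonicalForm_of_block_scalar hP hM
    · exact hasCanonicalForm_of_block_lower hr hP hM
  · by_cases hr : r = 0
    · subst hr
      exact hasCanonicalForm_of_block_upper hp hP hM
    · exact hasCanonicalForm_of_block_full hp hr hP hM

/-- A vector that is an eigenvector in the coordinates of a hyperbolic frame is an eigenvector. -/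
lemma mulVec_transpose_frame {A P M : Matrix (Fin 3) (Fin 3) ℂ} (hP : P * Pᵀ = hyperbolicGram)
    (hM : P * A * Pᵀ = M) {y : Fin 3 → ℂ} {l : ℂ} (hy : M *ᵥ y = l • (hyperbolicGram *ᵥ y)) :
    A *ᵥ (Pᵀ *ᵥ y) = l • (Pᵀ *ᵥ y) := by
  have hJ : hyperbolicGram * hyperbolicGram = 1 := by
    ext a b
    fin_cases a <;> fin_cases b <;> simp [hyperbolicGram, mul_apply, Fin.sum_univ_three]
  have hinv : (Pᵀ * hyperbolicGram) * P = 1 := by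
    rw [mul_eq_one_comm, ← Matrix.mul_assoc, hP, hJ]
  have h := congrArg ((Pᵀ * hyperbolicGram) *ᵥ ·) hy
  simp only [mulVec_smul, ← hM, mulVec_mulVec] at h
  rw [Matrix.mul_assoc P, ← Matrix.mul_assoc _ P, hinv, Matrix.one_mul, Matrix.mul_assoc, hJ,
    Matrix.mul_one] at h
  rw [mulVec_mulVec, h]

lemma dotProduct_transpose_frame {P : Matrix (Fin 3) (Fin 3) ℂ} (hP : P * Pᵀ = hyperbolicGram)
    (y : Fin 3 → ℂ) : (Pᵀ *ᵥ y) ⬝ᵥ (Pᵀ *ᵥ y) = y ⬝ᵥ (hyperbolicGram *ᵥ y) := by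
  rw [← hP, ← mulVec_mulVec, dotProduct_mulVec y, ← mulVec_transpose]

lemma hasCanonicalForm_of_nilpotent_block {A P : Matrix (Fin 3) (Fin 3) ℂ}
    {a b c : ℂ} (hb : b ≠ 0)
    (hP : P * Pᵀ = hyperbolicGram) (hM : P * A * Pᵀ = !![0, 0, a; 0, a, b; a, b, c]) :
    HasCanonicalForm A := by
  have hI := I_sq
  obtain ⟨t, ht⟩ : ∃ t : ℂ, c = -2 * b * t := ⟨-c / (2 * b), by field_simp⟩
  obtain ⟨S, h1, h2, h3⟩ := exists_special_orthogonal_of_frame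
    (N := !![a, 1 + I, 0; 1 + I, a, 1 - I; 0, 1 - I, a]) hP hM
    !![(1 - I) / 4 * b - (1 + I) * b⁻¹ * t ^ 2 / 2, (1 + I) * b⁻¹ * t, (1 + I) * b⁻¹;
      -t, 1, 0;
      (1 + I) / 4 * b - (1 - I) * b⁻¹ * t ^ 2 / 2, (1 - I) * b⁻¹ * t, (1 - I) * b⁻¹]
    (by
      ext a b
      fin_cases a <;> fin_cases b <;>
        simp [hyperbolicGram, mul_apply, Fin.sum_univ_three] <;> grind)
    (by
      ext a b
      fin_cases a <;> fin_cases b <;>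
        simp [mul_apply, Fin.sum_univ_three] <;> grind)
  exact ⟨S, h1, h2, .inr (.inr ⟨_, h3⟩)⟩

lemma hasCanonicalForm_of_isotropic_eigenvector {A : Matrix (Fin 3) (Fin 3) ℂ} (hA : Aᵀ = A)
    {v : Fin 3 → ℂ} {l : ℂ} (hv0 : v ≠ 0) (hv : v ⬝ᵥ v = 0) (hl : A *ᵥ v = l • v) :
    HasCanonicalForm A := by
  obtain ⟨P, hP, rfl⟩ := exists_frame_of_isotropic hv0 hv
  have hrow := frame_mul_apply_of_eigenvector hA hP 0 hl
  have hs : (P * A * Pᵀ)ᵀ = P * A * Pᵀ := by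
    simp [transpose_mul, hA, Matrix.mul_assoc]
  obtain ⟨a, b, c, hM⟩ : ∃ a b c : ℂ, P * A * Pᵀ = !![0, 0, l; 0, a, b; l, b, c] := by
    refine ⟨(P * A * Pᵀ) 1 1, (P * A * Pᵀ) 1 2, (P * A * Pᵀ) 2 2, ?_⟩
    generalize P * A * Pᵀ = M at *
    have h21 : M 2 1 = M 1 2 := congrFun (congrFun hs 1) 2
    ext a b
    fin_cases a <;> fin_cases b <;>
      simp [hrow, h21, hyperbolicGram]
  have key : ∀ k : ℂ, l * k + b = a * k → HasCanonicalForm A := fun k hk => by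
    refine hasCanonicalForm_of_unit_eigenvector hA (v := Pᵀ *ᵥ ![k, 1, 0]) (l := a) ?_
      (mulVec_transpose_frame hP hM ?_)
    · rw [dotProduct_transpose_frame hP]
      simp [hyperbolicGram, vecHead, vecTail]
    · ext i
      fin_cases i <;> simp [hyperbolicGram, ← hk, mul_comm k]
  by_cases ha : a = l
  · by_cases hb : b = 0
    · exact key 0 (by simp [hb])
    · subst ha
      exact hasCanonicalForm_of_nilpotent_block hb hP hM
  · have hal : a - l ≠ 0 := sub_ne_zero.mpr ha
    exact key (b / (a - l)) (by field_simp; ring)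

lemma hasCanonicalForm_of_symmetric {A : Matrix (Fin 3) (Fin 3) ℂ} (hA : Aᵀ = A) :
    HasCanonicalForm A := by
  obtain ⟨l, hl⟩ := Module.End.exists_eigenvalue (toLin' A)
  obtain ⟨v, hv⟩ := hl.exists_hasEigenvector
  have hAv : A *ᵥ v = l • v := by simpa using hv.apply_eq_smul
  by_cases h : v ⬝ᵥ v = 0
  · exact hasCanonicalForm_of_isotropic_eigenvector hA hv.2 h hAv
  · obtain ⟨s, hs0, hs⟩ := exists_ne_zero_pow_eq h two_pos
    refine hasCanonicalForm_of_unit_eigenvector hA (v := s⁻¹ • v) (l := l) ?_ ?_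
    · simp [← hs]
      field_simp
    · rw [mulVec_smul, hAv, smul_comm]

/-- Canonical forms of 3×3 complex symmetric matrices under the
congruence action of `SO(3,ℂ)`: for every symmetric `A` there is `T ∈ SO(3,ℂ)`
such that `TAT⁻¹ = TATᵀ` is one of the listed matrices. -/
theorem statement14 (A : Matrix (Fin 3) (Fin 3) ℂ) (hA : Aᵀ = A) :
    ∃ T : Matrix (Fin 3) (Fin 3) ℂ, Tᵀ * T = 1 ∧ T.det = 1 ∧
      ((∃ l1 l2 l3 : ℂ, T * A * Tᵀ = !![l1, 0, 0; 0, l2, 0; 0, 0, l3]) ∨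
       (∃ l1 l2 : ℂ, T * A * Tᵀ =
          !![l1, 0, 0; 0, l2 + Complex.I, 1; 0, 1, l2 - Complex.I]) ∨
       (∃ l : ℂ, T * A * Tᵀ =
          !![l, 1 + Complex.I, 0; 1 + Complex.I, l, 1 - Complex.I; 0, 1 - Complex.I, l]) ∨
       (∃ l1 l2 : ℂ, l1 * l2 ≠ 0 ∧ T * A * Tᵀ = !![l1, 0, 0; 0, l2, 0; 0, 0, 0]) ∨
       (∃ l : ℂ, l ≠ 0 ∧ T * A * Tᵀ =
          !![l + Complex.I, 1, 0; 1, l - Complex.I, 0; 0, 0, 0]) ∨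
       (∃ l : ℂ, l ≠ 0 ∧ T * A * Tᵀ =
          !![l, 0, 0; 0, Complex.I, 1; 0, 1, -Complex.I]) ∨
       (T * A * Tᵀ =
          !![0, 1 + Complex.I, 0; 1 + Complex.I, 0, 1 - Complex.I; 0, 1 - Complex.I, 0]) ∨
       (∃ l : ℂ, l ≠ 0 ∧ T * A * Tᵀ = !![l, 0, 0; 0, 0, 0; 0, 0, 0]) ∨
       (T * A * Tᵀ = !![Complex.I, 1, 0; 1, -Complex.I, 0; 0, 0, 0]) ∨
       (T * A * Tᵀ = 0)) := by
  obtain ⟨T, h1, h2, h | h | h⟩ := hasCanonicalForm_of_symmetric hA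
  · exact ⟨T, h1, h2, .inl h⟩
  · exact ⟨T, h1, h2, .inr (.inl h)⟩
  · exact ⟨T, h1, h2, .inr (.inr (.inl h))⟩
end

section
/- If a 3×3 complex matrix A satisfies the matrix equation Aᵀ((tr(A)+1)I₃ − A) = adj(A) and A is invertible, then A is symmetric, i.e., Aᵀ = A. -/
open Matrix

/-- The axial vector of the skew part `A - Aᵀ` of a solution of the matrix equation is an
eigenvector of `A` for `tr(A) + 1`. -/
lemma mulVec_axial_eq_zero {R : Type*} [CommRing R] (A : Matrix (Fin 3) (Fin 3) R)
    (hA : Aᵀ * ((A.trace + 1) • (1 : Matrix (Fin 3) (Fin 3) R) - A) = A.adjugate) :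
    ((A.trace + 1) • (1 : Matrix (Fin 3) (Fin 3) R) - A) *ᵥ
      ![A 2 1 - A 1 2, A 0 2 - A 2 0, A 1 0 - A 0 1] = 0 := by
  have h (i j : Fin 3) := congrFun (congrFun hA i) j
  have h01 := h 0 1
  have h10 := h 1 0
  have h02 := h 0 2
  have h20 := h 2 0
  have h12 := h 1 2
  have h21 := h 2 1
  simp [Matrix.mul_apply, Fin.sum_univ_three, Matrix.trace, Matrix.adjugate_fin_three]
    at h01 h10 h02 h20 h12 h21
  ext i
  fin_cases i <;>
    simp [Matrix.mulVec, dotProduct, Fin.sum_univ_three, Matrix.trace]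
  · linear_combination h12 - h21
  · linear_combination h20 - h02
  · linear_combination h01 - h10

/-- Any invertible solution `A` of the matrix equation
`Aᵀ((tr(A)+1)I₃ − A) = adj(A)` is symmetric. -/
theorem statement15 (A : Matrix (Fin 3) (Fin 3) ℂ)
    (hA : Aᵀ * ((A.trace + 1) • (1 : Matrix (Fin 3) (Fin 3) ℂ) - A) = A.adjugate)
    (hinv : IsUnit A) :
    Aᵀ = A := by
  have hdet : A.det ≠ 0 := ((Matrix.isUnit_iff_isUnit_det A).mp hinv).ne_zero
  have hadj : A.adjugate *ᵥ ![A 2 1 - A 1 2, A 0 2 - A 2 0, A 1 0 - A 0 1] = 0 := by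
    rw [← hA, ← Matrix.mulVec_mulVec, mulVec_axial_eq_zero A hA, Matrix.mulVec_zero]
  have hv : A.det • ![A 2 1 - A 1 2, A 0 2 - A 2 0, A 1 0 - A 0 1] = 0 := by
    rw [← Matrix.one_mulVec (![A 2 1 - A 1 2, A 0 2 - A 2 0, A 1 0 - A 0 1]),
      ← Matrix.smul_mulVec, ← Matrix.mul_adjugate, ← Matrix.mulVec_mulVec, hadj,
      Matrix.mulVec_zero]
  have hzero := (smul_eq_zero.mp hv).resolve_left hdet
  have h0 : A 2 1 = A 1 2 := sub_eq_zero.mp (congrFun hzero 0)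
  have h1 : A 0 2 = A 2 0 := sub_eq_zero.mp (congrFun hzero 1)
  have h2 : A 1 0 = A 0 1 := sub_eq_zero.mp (congrFun hzero 2)
  ext i j
  fin_cases i <;> fin_cases j <;> simp [h0, h1, h2]
end

section
/- If a 3×3 complex matrix A satisfies the matrix equation Aᵀ((tr(A)+1)I₃ − A) = adj(A) and A is invertible, then A is SO(3,ℂ)-congruent to −I₃; in fact, up to SO(3,ℂ)-congruence the only invertible solution of the matrix equation is A = −I₃. -/
open Matrix

theorem Matrix.two_smul_adjugate_fin_three {R : Type*} [CommRing R]
    (A : Matrix (Fin 3) (Fin 3) R) :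
    (2 : R) • A.adjugate =
      (2 : R) • (A * A) - (2 * A.trace) • A + (A.trace ^ 2 - (A * A).trace) • 1 := by
  ext i j
  fin_cases i <;> fin_cases j <;>
    simp [Matrix.adjugate_fin_three, Matrix.mul_apply, Matrix.trace, Fin.sum_univ_three] <;> ring

theorem Matrix.isSymm_of_transpose_mul_eq_adjugate {n R : Type*} [Fintype n] [DecidableEq n]
    [CommRing R] {A : Matrix n n R} {s : R} (h : Aᵀ * (s • 1 - A) = A.adjugate)
    (hA : IsUnit A) : Aᵀ = A := by
  have hT : IsUnit Aᵀ := by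
    rw [Matrix.isUnit_iff_isUnit_det, Matrix.det_transpose]
    exact (Matrix.isUnit_iff_isUnit_det A).1 hA
  have h₁ : Aᵀ * ((s • 1 - A) * A) = Aᵀ * A.adjugateᵀ := by
    rw [← Matrix.mul_assoc, h, Matrix.adjugate_mul, Matrix.adjugate_transpose,
      Matrix.mul_adjugate, Matrix.det_transpose]
  have h₂ : A.adjugate = Aᵀ * (s • 1 - Aᵀ) := by
    have := congrArg Matrix.transpose (hT.mul_left_cancel h₁)
    rw [Matrix.transpose_transpose, Matrix.transpose_mul] at this
    simpa using this.symm
  have h₃ := hT.mul_left_cancel (h.trans h₂)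
  exact (sub_right_injective h₃).symm

theorem Matrix.eq_neg_one_of_transpose_mul_eq_adjugate {A : Matrix (Fin 3) (Fin 3) ℂ}
    (h : Aᵀ * ((A.trace + 1) • 1 - A) = A.adjugate) (hA : IsUnit A) : A = -1 := by
  rw [Matrix.isSymm_of_transpose_mul_eq_adjugate h hA] at h
  have hadj := Matrix.two_smul_adjugate_fin_three A
  have hdet := Matrix.mul_adjugate A
  generalize A.det = d at hdet
  rw [← h] at hadj hdet
  have htr := congrArg Matrix.trace hadj
  simp only [Matrix.mul_sub, Matrix.mul_smul, Matrix.mul_one, Matrix.trace_add,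
    Matrix.trace_sub, Matrix.trace_smul, Matrix.trace_one, Fintype.card_fin, smul_eq_mul] at htr
  push_cast at htr
  have hsq : (A * A).trace = A.trace ^ 2 + 2 * A.trace := by linear_combination -htr
  rw [hsq] at hadj
  have hquad : (2 : ℂ) • (A * A) = (2 * A.trace + 1) • A + A.trace • 1 := by
    simp only [Matrix.mul_sub, Matrix.mul_smul, Matrix.mul_one] at hadj
    linear_combination (norm := module) (-1 / 2 : ℂ) • hadj
  have hcub : A * A = A.trace • A + (2 * d) • 1 := by
    have := congrArg (A * ·) hquad
    simp only [Matrix.mul_sub, Matrix.mul_add, Matrix.mul_smul, Matrix.mul_one] at this hdet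
    linear_combination (norm := module) this + (2 : ℂ) • hdet
  have hscalar : A = (4 * d - A.trace) • 1 := by
    linear_combination (norm := module) (2 : ℂ) • hcub - hquad
  generalize 4 * d - A.trace = c at hscalar
  subst hscalar
  have hc : c ≠ 0 := by
    rintro rfl
    simp at hA
  have h00 := congrFun (congrFun h 0) 0
  simp [Matrix.adjugate_fin_three] at h00
  have : c = -1 := by
    apply mul_left_cancel₀ hc
    linear_combination c * h00.resolve_right hc
  simp [this]

/-- Up to `SO(3,ℂ)`-congruence, the only invertible solution of
the matrix equation `Aᵀ((tr(A)+1)I₃ − A) = adj(A)` is `−I₃`: every invertible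
solution is `SO(3,ℂ)`-congruent to `−I₃` (and `−I₃` is an invertible solution). -/
theorem statement16 :
    (∀ A : Matrix (Fin 3) (Fin 3) ℂ,
      Aᵀ * ((A.trace + 1) • (1 : Matrix (Fin 3) (Fin 3) ℂ) - A) = A.adjugate →
      IsUnit A →
      ∃ T : Matrix (Fin 3) (Fin 3) ℂ, Tᵀ * T = 1 ∧ T.det = 1 ∧
        Tᵀ * A * T = (-1 : Matrix (Fin 3) (Fin 3) ℂ)) ∧
    ((-1 : Matrix (Fin 3) (Fin 3) ℂ)ᵀ *
        (((-1 : Matrix (Fin 3) (Fin 3) ℂ).trace + 1) • (1 : Matrix (Fin 3) (Fin 3) ℂ)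
          - (-1 : Matrix (Fin 3) (Fin 3) ℂ))
      = (-1 : Matrix (Fin 3) (Fin 3) ℂ).adjugate) ∧
    IsUnit (-1 : Matrix (Fin 3) (Fin 3) ℂ) := by
  refine ⟨fun A h hA => ⟨1, by simp, by simp, ?_⟩, ?_, isUnit_one.neg⟩
  · simpa using Matrix.eq_neg_one_of_transpose_mul_eq_adjugate h hA
  · ext i j
    fin_cases i <;> fin_cases j <;>
      simp [Matrix.adjugate_fin_three, Matrix.mul_apply,
        Fin.sum_univ_three] <;> norm_num
end

section
/- If a 3×3 complex matrix A satisfies the matrix equation Aᵀ((tr(A)+1)I₃ − A) = adj(A) and rank(A) = 2, then (tr(A)+1)·AᵀA = AᵀAA, and the rank of AᵀA is 1 or 2. -/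
open Matrix

/-- If `A` is a rank-2 solution of
`Aᵀ((tr(A)+1)I₃ − A) = adj(A)`, then `(tr(A)+1)·AᵀA = AᵀAA` and
`rank(AᵀA) ∈ {1, 2}`. -/
theorem statement17 (A : Matrix (Fin 3) (Fin 3) ℂ)
    (hA : Aᵀ * ((A.trace + 1) • (1 : Matrix (Fin 3) (Fin 3) ℂ) - A) = A.adjugate)
    (hrank : A.rank = 2) :
    (A.trace + 1) • (Aᵀ * A) = Aᵀ * A * A ∧
    ((Aᵀ * A).rank = 1 ∨ (Aᵀ * A).rank = 2) := by
  have hdet : A.det = 0 := by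
    by_contra h
    have := rank_of_det_ne_zero h
    simp [hrank] at this
  constructor
  · have h := congrArg (· * A) hA
    simp only [adjugate_mul, hdet, zero_smul] at h
    rw [← sub_eq_zero, ← h]
    simp [mul_sub, sub_mul]
  · have hle : (Aᵀ * A).rank ≤ 2 := hrank ▸ rank_mul_le_right Aᵀ A
    have hne : (Aᵀ * A).rank ≠ 0 := by
      intro h0
      have hzero : Aᵀ * A = 0 := by
        rw [Matrix.rank, Submodule.finrank_eq_zero, LinearMap.range_eq_bot] at h0
        exact Matrix.ext_of_mulVec_single fun i => by
          rw [zero_mulVec]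
          exact LinearMap.congr_fun h0 (Pi.single i 1)
      have := rank_add_rank_le_card_of_mul_eq_zero hzero
      simp [hrank, rank_transpose] at this
    omega
end

section
/- If a 3×3 complex matrix A satisfies the matrix equation Aᵀ((tr(A)+1)I₃ − A) = adj(A), rank(A) = 1, and A is not symmetric (Aᵀ ≠ A), then tr(A) = −1, AᵀA = 0, and rank(A + Aᵀ) = 2. -/
open Matrix

theorem Matrix.exists_eq_vecMulVec_of_rank_eq_one {m n K : Type*} [Fintype n] [DecidableEq n]
    [Field K] {A : Matrix m n K} (h : A.rank = 1) :
    ∃ (u : m → K) (v : n → K), A = vecMulVec u v := by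
  obtain ⟨⟨u, _⟩, -, hu⟩ := finrank_eq_one_iff'.mp h
  choose c hc using fun j => hu ⟨A.mulVecLin (Pi.single j 1), LinearMap.mem_range_self _ _⟩
  refine ⟨u, c, ?_⟩
  ext i j
  have hij := congrFun (congrArg Subtype.val (hc j)) i
  simp only [SetLike.mk_smul_mk, Pi.smul_apply, smul_eq_mul, mulVecLin_apply,
    mulVec_single_one, col_apply] at hij
  rw [vecMulVec_apply, ← hij, mul_comm]

theorem Matrix.adjugate_vecMulVec_fin_three {R : Type*} [CommRing R] (u v : Fin 3 → R) :
    (vecMulVec u v).adjugate = 0 := by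
  rw [adjugate_fin_three]
  ext i j
  fin_cases i <;> fin_cases j <;> simp [vecMulVec_apply] <;> ring

theorem Matrix.rank_vecMulVec_add_transpose {n K : Type*} [Fintype n] [Field K] {u v : n → K}
    (huu : u ⬝ᵥ u = 0) (huv : u ⬝ᵥ v ≠ 0) :
    (vecMulVec u v + (vecMulVec u v)ᵀ).rank = 2 := by
  let P : Matrix n (Fin 2) K := (of ![u, v])ᵀ
  let Q : Matrix (Fin 2) n K := of ![v, u]
  have hS : vecMulVec u v + (vecMulVec u v)ᵀ = P * Q := by
    ext i j
    simp [P, Q, mul_apply, vecMulVec_apply, Fin.sum_univ_two, mul_comm]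
  have hQP : (Q * P).det = (u ⬝ᵥ v) ^ 2 := by
    calc (Q * P).det = v ⬝ᵥ u * u ⬝ᵥ v - v ⬝ᵥ v * u ⬝ᵥ u := det_fin_two _
      _ = (u ⬝ᵥ v) ^ 2 := by rw [huu, dotProduct_comm v u]; ring
  rw [hS]
  apply le_antisymm
  · exact (rank_mul_le_left P Q).trans (by simpa using rank_le_card_width P)
  · have hr : (Q * P * (Q * P)).rank = 2 := by
      rw [rank_of_det_ne_zero (by simp [hQP, huv]), Fintype.card_fin]
    calc 2 = (Q * (P * Q) * P).rank := by simpa only [Matrix.mul_assoc] using hr.symm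
      _ ≤ (Q * (P * Q)).rank := rank_mul_le_left _ _
      _ ≤ (P * Q).rank := rank_mul_le_right _ _

/-- If `A` is a rank-1, non-symmetric solution of
`Aᵀ((tr(A)+1)I₃ − A) = adj(A)`, then `tr(A) = −1`, `AᵀA = 0` and
`rank(A + Aᵀ) = 2`. -/
theorem statement18 (A : Matrix (Fin 3) (Fin 3) ℂ)
    (hA : Aᵀ * ((A.trace + 1) • (1 : Matrix (Fin 3) (Fin 3) ℂ) - A) = A.adjugate)
    (hrank : A.rank = 1) (hsym : Aᵀ ≠ A) :
    A.trace = -1 ∧ Aᵀ * A = 0 ∧ (A + Aᵀ).rank = 2 := by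
  obtain ⟨u, v, rfl⟩ := exists_eq_vecMulVec_of_rank_eq_one hrank
  set A := vecMulVec u v with hAuv
  rw [hAuv, adjugate_vecMulVec_fin_three, ← hAuv, mul_sub, mul_smul_comm, mul_one,
    sub_eq_zero] at hA
  have ht : A.trace + 1 = 0 := by
    by_contra hne
    have hA' := congrArg transpose hA
    rw [transpose_smul, transpose_mul, transpose_transpose, ← hA] at hA'
    exact hsym (smul_right_injective _ hne hA').symm
  have hAA : Aᵀ * A = 0 := by rw [← hA, ht, zero_smul]
  have htr : A.trace = -1 := eq_neg_of_add_eq_zero_left ht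
  have huv : u ⬝ᵥ v ≠ 0 := by
    rw [← trace_vecMulVec, ← hAuv, htr]
    exact neg_ne_zero.mpr one_ne_zero
  have hv : v ≠ 0 := by
    rintro rfl
    exact huv (dotProduct_zero u)
  have huu : u ⬝ᵥ u = 0 := by
    have h := hAA
    rw [hAuv, transpose_vecMulVec, vecMulVec_mul, vecMul_vecMulVec, vecMulVec_eq_zero,
      or_iff_right hv, smul_eq_zero, or_iff_left hv] at h
    exact h
  exact ⟨htr, hAA, rank_vecMulVec_add_transpose huu huv⟩
end
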